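/- For any bounded measurable function φ on X and all N ≥ 1, E[γ_n^N(1)² V_n^N(φ)] = var(γ_n^N(φ)). -/

import Mathlib

open MeasureTheory ProbabilityTheory Filter
open scoped ENNReal NNReal Classical

noncomputable section

namespace PFVar

variable {X : Type*} [MeasurableSpace X]

/-- The unnormalized Feynman–Kac measures `γ_p`. -/
def gammaFK (M0 : Measure X) (M : ℕ → Kernel X X) (G : ℕ → X → ℝ) : ℕ → Measure X
  | 0 => M0
  | p + 1 =>
      ((gammaFK M0 M G p).withDensity fun x => ENNReal.ofReal (G p x)).bind
        (fun x => M (p + 1) x)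

/-- `γ_n(φ)`. -/
def gInt (M0 : Measure X) (M : ℕ → Kernel X X) (G : ℕ → X → ℝ) (n : ℕ) (φ : X → ℝ) : ℝ :=
  ∫ x, φ x ∂(gammaFK M0 M G n)

/-- `η_n(φ) = γ_n(φ)/γ_n(1)`. -/
def eInt (M0 : Measure X) (M : ℕ → Kernel X X) (G : ℕ → X → ℝ) (n : ℕ) (φ : X → ℝ) : ℝ :=
  gInt M0 M G n φ / gInt M0 M G n 1

/-- Law of the path `(X_0,…,X_k)` of an inhomogeneous Markov chain with initial law `μ0` and
transitions `κ`, recorded as an element of `ℕ → Y` (coordinates beyond `k` are junk). -/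
def markovPath {Y : Type*} [MeasurableSpace Y] (μ0 : Measure Y) (κ : ℕ → Y → Measure Y) :
    ℕ → Measure (ℕ → Y)
  | 0 => μ0.map fun y _ => y
  | k + 1 =>
      (markovPath μ0 κ k).bind fun ω =>
        (κ (k + 1) (ω k)).map fun y => Function.update ω (k + 1) y

/-- Categorical distribution on `{0,…,m−1} ⊆ ℕ` with weights `w`. -/
def cat (m : ℕ) (w : ℕ → ℝ) : Measure ℕ :=
  (∑ j ∈ Finset.range m, ENNReal.ofReal (w j))⁻¹ •
    ∑ j ∈ Finset.range m, ENNReal.ofReal (w j) • Measure.dirac j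

/-- Uniform distribution on `{0,…,m−1}`. -/
def unif (m : ℕ) : Measure ℕ := cat m fun _ => 1

/-- Extend a finite tuple to `ℕ` with junk values. -/
def padF {Y : Type*} [Nonempty Y] {m : ℕ} (f : Fin m → Y) : ℕ → Y := fun i =>
  if h : i < m then f ⟨i, h⟩ else Classical.arbitrary Y

/-- One resampling/mutation step of the particle filter: given the time-`p` configuration `z`,
the joint law of the ancestor indices `A_p` and the time-`p+1` particle configuration;
each of the `Np (p+1)` new particles independently draws an ancestor from the categorical
distribution with weights `G p (z j)`, `j < Np p`, and then moves according to `M (p+1)`. -/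
def pfStep [Nonempty X] (M : ℕ → Kernel X X) (G : ℕ → X → ℝ) (Np : ℕ → ℕ) (p : ℕ)
    (z : ℕ → X) : Measure ((ℕ → ℕ) × (ℕ → X)) :=
  (Measure.pi fun _ : Fin (Np (p + 1)) =>
      (cat (Np p) fun j => G p (z j)).bind fun a =>
        (M (p + 1) (z a)).map fun x => (a, x)).map fun f =>
    (padF fun i => (f i).1, padF fun i => (f i).2)

/-- The law of the particle system `(ζ, A)` run up to time `k`: the first component is
`ζ : time → particle index → X`, the second is `A : time → particle index → ℕ`, where
`A p i` is the ancestor index of particle `i` of generation `p+1`. -/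
def pfLaw [Nonempty X] (M0 : Measure X) (M : ℕ → Kernel X X) (G : ℕ → X → ℝ)
    (Np : ℕ → ℕ) : ℕ → Measure ((ℕ → ℕ → X) × (ℕ → ℕ → ℕ))
  | 0 =>
      (Measure.pi fun _ : Fin (Np 0) => M0).map fun f =>
        (fun p => if p = 0 then padF f else fun _ => Classical.arbitrary X, fun _ _ => 0)
  | k + 1 =>
      (pfLaw M0 M G Np k).bind fun ω =>
        (pfStep M G Np k (ω.1 k)).map fun az =>
          (Function.update ω.1 (k + 1) az.2, Function.update ω.2 k az.1)

/-- Eve indices: `eve A 0 i = i` and `eve A (p+1) i = eve A p (A p i)`. -/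
def eve (A : ℕ → ℕ → ℕ) : ℕ → ℕ → ℕ
  | 0 => fun i => i
  | p + 1 => fun i => eve A p (A p i)

/-- `η_n^N(φ)`. -/
def etaN (Np : ℕ → ℕ) (n : ℕ) (φ : X → ℝ) (ω : (ℕ → ℕ → X) × (ℕ → ℕ → ℕ)) : ℝ :=
  (Np n : ℝ)⁻¹ * ∑ i ∈ Finset.range (Np n), φ (ω.1 n i)

/-- `γ_n^N(φ)`. -/
def gammaN (G : ℕ → X → ℝ) (Np : ℕ → ℕ) (n : ℕ) (φ : X → ℝ)
    (ω : (ℕ → ℕ → X) × (ℕ → ℕ → ℕ)) : ℝ :=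
  (∏ p ∈ Finset.range n, etaN Np p (G p) ω) * etaN Np n φ ω

/-- The variance estimator `V_n^N(φ)`. -/
def Vest (Np : ℕ → ℕ) (n : ℕ) (φ : X → ℝ) (ω : (ℕ → ℕ → X) × (ℕ → ℕ → ℕ)) : ℝ :=
  etaN Np n φ ω ^ 2 -
    (∏ p ∈ Finset.range n, (Np p : ℝ) / ((Np p : ℝ) - 1)) *
      ((Np n : ℝ) * ((Np n : ℝ) - 1))⁻¹ *
      ∑ i ∈ Finset.range (Np n), ∑ j ∈ Finset.range (Np n),
        if eve ω.2 n i ≠ eve ω.2 n j then φ (ω.1 n i) * φ (ω.1 n j) else 0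

/-- Initial law of the doubled chain used to define `μ_b`. -/
def pairInit (M0 : Measure X) (b : ℕ → Bool) : Measure (X × X) :=
  if b 0 then M0.map fun x => (x, x) else M0.prod M0

/-- Transitions of the doubled chain used to define `μ_b`. -/
def pairKer (M : ℕ → Kernel X X) (b : ℕ → Bool) (p : ℕ) (q : X × X) : Measure (X × X) :=
  if b p then (M p q.1).map fun y => (y, y) else (M p q.1).prod (M p q.2)

/-- `μ_b(φ) = E_b[φ(X_n, X_n') ∏_{p<n} G_p(X_p) G_p(X_p')]`. -/
def muB (M0 : Measure X) (M : ℕ → Kernel X X) (G : ℕ → X → ℝ) (n : ℕ) (b : ℕ → Bool)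
    (φ : X × X → ℝ) : ℝ :=
  ∫ ω, φ (ω n) * ∏ p ∈ Finset.range n, G p (ω p).1 * G p (ω p).2
    ∂(markovPath (pairInit M0 b) (pairKer M b) n)

/-- `φ ⊗ φ`. -/
def tens (φ : X → ℝ) : X × X → ℝ := fun q => φ q.1 * φ q.2

/-- The binary string `e_p`. -/
def eVec (p : ℕ) : ℕ → Bool := fun q => q == p

/-- The zero binary string `0_n`. -/
def zeroVec : ℕ → Bool := fun _ => false

/-- Extension of a finite binary string to `ℕ → Bool`. -/
def extB (n : ℕ) (b : Fin (n + 1) → Bool) : ℕ → Bool := fun p =>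
  if h : p < n + 1 then b ⟨p, h⟩ else false

/-- `v_{p,n}(φ) = (μ_{e_p}(φ⊗φ) − μ_{0_n}(φ⊗φ)) / γ_n(1)²`. -/
def vpn (M0 : Measure X) (M : ℕ → Kernel X X) (G : ℕ → X → ℝ) (n p : ℕ) (φ : X → ℝ) : ℝ :=
  (muB M0 M G n (eVec p) (tens φ) - muB M0 M G n zeroVec (tens φ)) / gInt M0 M G n 1 ^ 2

/-- `σ_n²(φ) = Σ_{p=0}^n c_p⁻¹ v_{p,n}(φ)`. -/
def sigma2 (M0 : Measure X) (M : ℕ → Kernel X X) (G : ℕ → X → ℝ) (c : ℕ → ℝ) (n : ℕ)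
    (φ : X → ℝ) : ℝ :=
  ∑ p ∈ Finset.range (n + 1), (c p)⁻¹ * vpn M0 M G n p φ

/-- Particle numbers `N_p = ⌈c_p N⌉`. -/
def npart (c : ℕ → ℝ) (N : ℕ) (p : ℕ) : ℕ := ⌈c p * (N : ℝ)⌉₊

/-- Backward tracing: `traceAux A n kn j = K_{n-j}` where `K_n = kn`, `K_p = A p (K_{p+1})`. -/
def traceAux (A : ℕ → ℕ → ℕ) (n kn : ℕ) : ℕ → ℕ
  | 0 => kn
  | j + 1 => A (n - (j + 1)) (traceAux A n kn j)

/-- The deterministic ancestral trace `K¹`: `trace A n kn p = K_p¹` given `K_n¹ = kn`. -/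
def trace (A : ℕ → ℕ → ℕ) (n kn : ℕ) : ℕ → ℕ := fun p => traceAux A n kn (n - p)

/-- Conditional law of the broken-lineage trace `(K_0²,…,K_p²)` given `K_p² = v`
(entries above `p` are junk, to be overwritten). -/
def k2Law (G : ℕ → X → ℝ) (Np : ℕ → ℕ) (ω : (ℕ → ℕ → X) × (ℕ → ℕ → ℕ)) (K1 : ℕ → ℕ) :
    ℕ → ℕ → Measure (ℕ → ℕ)
  | 0 => fun v => Measure.dirac fun q => if q = 0 then v else 0
  | p + 1 => fun v =>
      ((if v = K1 (p + 1) then cat (Np p) fun j => G p (ω.1 p j)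
          else Measure.dirac (ω.2 p v)).bind fun w =>
        (k2Law G Np ω K1 p w).map fun f => Function.update f (p + 1) v)

/-- Conditional law of `(K¹, K²)` given the particle system `ω = (ζ, A)`. -/
def kLaw (G : ℕ → X → ℝ) (Np : ℕ → ℕ) (n : ℕ) (ω : (ℕ → ℕ → X) × (ℕ → ℕ → ℕ)) :
    Measure ((ℕ → ℕ) × (ℕ → ℕ)) :=
  (unif (Np n)).bind fun k1n =>
    (unif (Np n)).bind fun k2n =>
      (k2Law G Np ω (trace ω.2 n k1n) n k2n).map fun k2 => (trace ω.2 n k1n, k2)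

/-- Joint law of the particle system together with the tracing variables `(K¹, K²)`. -/
def pfkLaw [Nonempty X] (M0 : Measure X) (M : ℕ → Kernel X X) (G : ℕ → X → ℝ)
    (Np : ℕ → ℕ) (n : ℕ) :
    Measure (((ℕ → ℕ → X) × (ℕ → ℕ → ℕ)) × ((ℕ → ℕ) × (ℕ → ℕ))) :=
  (pfLaw M0 M G Np n).bind fun ω => (kLaw G Np n ω).map fun k => (ω, k)

/-- `(k¹, k²) ∈ I(b)`. -/
def inI (Np : ℕ → ℕ) (n : ℕ) (b : ℕ → Bool) (k : (ℕ → ℕ) × (ℕ → ℕ)) : Prop :=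
  ∀ p ≤ n, k.1 p < Np p ∧ k.2 p < Np p ∧ (k.1 p = k.2 p ↔ b p = true)

/-- The particle approximation `μ_b^N(φ)` (a function of the realization `ω = (ζ, A)`);
the conditional expectation given `(A, ζ)` is the integral with respect to `kLaw`. -/
def muBN (G : ℕ → X → ℝ) (Np : ℕ → ℕ) (n : ℕ) (b : ℕ → Bool) (φ : X × X → ℝ)
    (ω : (ℕ → ℕ → X) × (ℕ → ℕ → ℕ)) : ℝ :=
  (∏ p ∈ Finset.range (n + 1),
      if b p then (Np p : ℝ) else (Np p : ℝ) / ((Np p : ℝ) - 1)) *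
    gammaN G Np n 1 ω ^ 2 *
    ∫ k, (if inI Np n b k then (1 : ℝ) else 0) * φ (ω.1 n (k.1 n), ω.1 n (k.2 n))
      ∂(kLaw G Np n ω)

/-- `v_{p,n}^N(φ)`. -/
def vpnN (G : ℕ → X → ℝ) (Np : ℕ → ℕ) (n p : ℕ) (φ : X → ℝ)
    (ω : (ℕ → ℕ → X) × (ℕ → ℕ → ℕ)) : ℝ :=
  (muBN G Np n (eVec p) (tens φ) ω - muBN G Np n zeroVec (tens φ) ω) / gammaN G Np n 1 ω ^ 2

/-- `v_n^N(φ) = Σ_{p=0}^n c_p⁻¹ v_{p,n}^N(φ)`. -/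
def vnN (G : ℕ → X → ℝ) (Np : ℕ → ℕ) (c : ℕ → ℝ) (n : ℕ) (φ : X → ℝ)
    (ω : (ℕ → ℕ → X) × (ℕ → ℕ → ℕ)) : ℝ :=
  ∑ p ∈ Finset.range (n + 1), (c p)⁻¹ * vpnN G Np n p φ ω

/-- `QAux M G n φ j = Q_{n-j,n}(φ)`. -/
def QAux (M : ℕ → Kernel X X) (G : ℕ → X → ℝ) (n : ℕ) (φ : X → ℝ) : ℕ → X → ℝ
  | 0 => φ
  | j + 1 => fun x => G (n - (j + 1)) x * ∫ y, QAux M G n φ j y ∂(M (n - j) x)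

/-- `Q_{p,n}(φ)` where `Q_p(x, dx') = G_{p-1}(x) M_p(x, dx')`, `Q_{n,n} = Id`,
`Q_{p,n} = Q_{p+1} ⋯ Q_n`. -/
def Qpn (M : ℕ → Kernel X X) (G : ℕ → X → ℝ) (n p : ℕ) (φ : X → ℝ) : X → ℝ :=
  QAux M G n φ (n - p)

/-- `φ̂ = G_n · φ`. -/
def hatf (G : ℕ → X → ℝ) (n : ℕ) (φ : X → ℝ) : X → ℝ := fun x => G n x * φ x

/-- `γ̂_n(φ) = γ_n(G_n φ)`. -/
def gHatInt (M0 : Measure X) (M : ℕ → Kernel X X) (G : ℕ → X → ℝ) (n : ℕ) (φ : X → ℝ) : ℝ :=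
  gInt M0 M G n (hatf G n φ)

/-- `η̂_n(φ) = γ̂_n(φ)/γ̂_n(1)`. -/
def eHatInt (M0 : Measure X) (M : ℕ → Kernel X X) (G : ℕ → X → ℝ) (n : ℕ) (φ : X → ℝ) : ℝ :=
  gHatInt M0 M G n φ / gHatInt M0 M G n 1

/-- `γ̂_n^N(φ) = γ_n^N(G_n φ)`. -/
def gammaHatN (G : ℕ → X → ℝ) (Np : ℕ → ℕ) (n : ℕ) (φ : X → ℝ)
    (ω : (ℕ → ℕ → X) × (ℕ → ℕ → ℕ)) : ℝ :=
  gammaN G Np n (hatf G n φ) ω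

/-- `η̂_n^N(φ) = γ̂_n^N(φ)/γ̂_n^N(1)`. -/
def etaHatN (G : ℕ → X → ℝ) (Np : ℕ → ℕ) (n : ℕ) (φ : X → ℝ)
    (ω : (ℕ → ℕ → X) × (ℕ → ℕ → ℕ)) : ℝ :=
  gammaHatN G Np n φ ω / gammaHatN G Np n 1 ω

/-- `v̂_{p,n}(φ) = v_{p,n}(φ̂)/η_n(G_n)²`. -/
def vpnHat (M0 : Measure X) (M : ℕ → Kernel X X) (G : ℕ → X → ℝ) (n p : ℕ) (φ : X → ℝ) : ℝ :=
  vpn M0 M G n p (hatf G n φ) / eInt M0 M G n (G n) ^ 2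

/-- `σ̂_n²(φ) = Σ_{p=0}^n c_p⁻¹ v̂_{p,n}(φ)`. -/
def sigma2Hat (M0 : Measure X) (M : ℕ → Kernel X X) (G : ℕ → X → ℝ) (c : ℕ → ℝ) (n : ℕ)
    (φ : X → ℝ) : ℝ :=
  ∑ p ∈ Finset.range (n + 1), (c p)⁻¹ * vpnHat M0 M G n p φ

/-- `V̂_n^N(φ) = V_n^N(φ̂)/η_n^N(G_n)²`. -/
def VestHat (G : ℕ → X → ℝ) (Np : ℕ → ℕ) (n : ℕ) (φ : X → ℝ)
    (ω : (ℕ → ℕ → X) × (ℕ → ℕ → ℕ)) : ℝ :=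
  Vest Np n (hatf G n φ) ω / etaN Np n (G n) ω ^ 2

/-- `v̂_{p,n}^N(φ) = v_{p,n}^N(φ̂)/η_n^N(G_n)²`. -/
def vpnHatN (G : ℕ → X → ℝ) (Np : ℕ → ℕ) (n p : ℕ) (φ : X → ℝ)
    (ω : (ℕ → ℕ → X) × (ℕ → ℕ → ℕ)) : ℝ :=
  vpnN G Np n p (hatf G n φ) ω / etaN Np n (G n) ω ^ 2

/-- `v̂_n^N(φ) = Σ_{p=0}^n c_p⁻¹ v̂_{p,n}^N(φ)`. -/
def vnHatN (G : ℕ → X → ℝ) (Np : ℕ → ℕ) (c : ℕ → ℝ) (n : ℕ) (φ : X → ℝ)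
    (ω : (ℕ → ℕ → X) × (ℕ → ℕ → ℕ)) : ℝ :=
  ∑ p ∈ Finset.range (n + 1), (c p)⁻¹ * vpnHatN G Np n p φ ω


open PFVar MeasureTheory ProbabilityTheory Filter

/-- Bounded measurable real-valued functions. -/
def BddMeas {α : Type*} [MeasurableSpace α] (f : α → ℝ) : Prop :=
  Measurable f ∧ ∃ C, ∀ x, |f x| ≤ C

namespace BddMeas

variable {α β : Type*} [MeasurableSpace α] [MeasurableSpace β] {f g : α → ℝ}

theorem measurable (hf : BddMeas f) : Measurable f := hf.1

theorem const (c : ℝ) : BddMeas fun _ : α => c := ⟨measurable_const, |c|, fun _ => le_rfl⟩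

theorem mul (hf : BddMeas f) (hg : BddMeas g) : BddMeas fun x => f x * g x := by
  obtain ⟨hf, C, hC⟩ := hf
  obtain ⟨hg, D, hD⟩ := hg
  refine ⟨hf.mul hg, C * D, fun x => ?_⟩
  rw [abs_mul]
  exact mul_le_mul (hC x) (hD x) (abs_nonneg _) ((abs_nonneg _).trans (hC x))

theorem sum {ι : Type*} (s : Finset ι) {f : ι → α → ℝ} (hf : ∀ i ∈ s, BddMeas (f i)) :
    BddMeas fun x => ∑ i ∈ s, f i x := by
  have hC : ∀ i, ∃ C, i ∈ s → ∀ x, |f i x| ≤ C := fun i => by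
    by_cases hi : i ∈ s
    · exact (hf i hi).2.imp fun C h _ => h
    · exact ⟨0, fun h => absurd h hi⟩
  choose C hC using hC
  exact ⟨Finset.measurable_sum s fun i hi => (hf i hi).1, ∑ i ∈ s, C i, fun x =>
    (Finset.abs_sum_le_sum_abs _ _).trans (Finset.sum_le_sum fun i hi => hC i hi x)⟩

theorem prod {ι : Type*} (s : Finset ι) {f : ι → α → ℝ} (hf : ∀ i ∈ s, BddMeas (f i)) :
    BddMeas fun x => ∏ i ∈ s, f i x := by
  induction s using Finset.cons_induction with
  | empty => simpa using const 1
  | cons a s ha ih =>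
    simp only [Finset.prod_cons]
    exact (hf a (by simp)).mul (ih fun i hi => hf i (by simp [hi]))

theorem pow (hf : BddMeas f) (k : ℕ) : BddMeas fun x => f x ^ k := by
  simpa using prod (Finset.range k) fun _ _ => hf

theorem comp (hf : BddMeas f) {g : β → α} (hg : Measurable g) : BddMeas fun x => f (g x) :=
  ⟨hf.1.comp hg, hf.2.imp fun _ h x => h (g x)⟩

theorem ite (hf : BddMeas f) {p : α → Prop} [DecidablePred p] (hp : MeasurableSet {x | p x}) :
    BddMeas fun x => if p x then f x else 0 := by
  obtain ⟨hf, C, hC⟩ := hf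
  refine ⟨hf.ite hp measurable_const, C, fun x => ?_⟩
  have := (abs_nonneg _).trans (hC x)
  dsimp only
  split_ifs <;> simp [hC, this]

theorem integrable (hf : BddMeas f) (μ : Measure α) [IsFiniteMeasure μ] : Integrable f μ :=
  .of_bound hf.1.aestronglyMeasurable hf.2.choose (.of_forall hf.2.choose_spec)

theorem memLp (hf : BddMeas f) (μ : Measure α) [IsFiniteMeasure μ] (p : ℝ≥0∞) : MemLp f p μ :=
  .of_bound hf.1.aestronglyMeasurable hf.2.choose (.of_forall hf.2.choose_spec)

theorem integral_kernel (hf : BddMeas f) (κ : Kernel β α) [IsMarkovKernel κ] :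
    BddMeas fun x => ∫ y, f y ∂κ x := by
  obtain ⟨hfm, C, hC⟩ := hf
  refine ⟨hfm.stronglyMeasurable.integral_kernel.measurable, C, fun x => ?_⟩
  simpa using norm_integral_le_of_norm_le_const (μ := κ x) (f := f) (.of_forall hC)

end BddMeas

theorem integral_bind_bddMeas {α β : Type*} [MeasurableSpace α] [MeasurableSpace β]
    {μ : Measure α} [IsProbabilityMeasure μ] {κ : α → Measure β} [∀ a, IsProbabilityMeasure (κ a)]
    (hκ : Measurable κ) {f : β → ℝ} (hf : BddMeas f) :
    ∫ y, f y ∂(μ.bind κ) = ∫ x, ∫ y, f y ∂(κ x) ∂μ := by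
  let K : Kernel α β := ⟨κ, hκ⟩
  have : IsMarkovKernel K := ⟨fun a => inferInstanceAs (IsProbabilityMeasure (κ a))⟩
  have h := Kernel.integral_comp (η := K) (κ := Kernel.const Unit μ) (a := ()) (hf.integrable _)
  rwa [Kernel.comp_apply, Kernel.const_apply] at h

theorem measurable_map_prodMk {α β γ : Type*} [MeasurableSpace α] [MeasurableSpace β]
    [MeasurableSpace γ] {κ : α → Measure β} [∀ a, IsProbabilityMeasure (κ a)]
    (hκ : Measurable κ) {g : α × β → γ} (hg : Measurable g) :
    Measurable fun a => (κ a).map fun b => g (a, b) := by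
  let K : Kernel α β := ⟨κ, hκ⟩
  have : IsMarkovKernel K := ⟨fun a => inferInstanceAs (IsProbabilityMeasure (κ a))⟩
  convert! ((Kernel.id ×ₖ K).map g).measurable using 2 with a
  rw [Kernel.map_apply _ hg, Kernel.prod_apply, Kernel.id_apply, Measure.dirac_prod,
    Measure.map_map hg measurable_prodMk_left]
  rfl

theorem measurable_measure_pi {α β ι : Type*} [MeasurableSpace α] [MeasurableSpace β] [Fintype ι]
    {κ : α → Measure β} [∀ a, IsProbabilityMeasure (κ a)] (hκ : Measurable κ) :
    Measurable fun a => Measure.pi fun _ : ι => κ a := by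
  refine .measure_of_isPiSystem_of_isProbabilityMeasure generateFrom_pi.symm isPiSystem_pi ?_
  rintro _ ⟨s, hs, rfl⟩
  simp only [Measure.pi_pi]
  exact Finset.measurable_prod _ fun i _ =>
    (Measure.measurable_coe (hs i (Set.mem_univ i))).comp hκ

theorem integral_pi_pair {β ι : Type*} [MeasurableSpace β] [Fintype ι] (ν : Measure β)
    [IsProbabilityMeasure ν] {i j : ι} (hij : i ≠ j) {H : β × β → ℝ} (hH : BddMeas H) :
    ∫ y, H (y i, y j) ∂(Measure.pi fun _ : ι => ν) = ∫ y, ∫ y', H (y, y') ∂ν ∂ν := by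
  have h := ((iIndepFun_pi (μ := fun _ : ι => ν) (X := fun _ b => b)
    fun _ => aemeasurable_id).indepFun hij).map_prod_eq_prod_map_map
      (measurable_pi_apply i).aemeasurable (measurable_pi_apply j).aemeasurable
  have he (k : ι) : (Measure.pi fun _ : ι => ν).map (fun y => y k) = ν :=
    (measurePreserving_eval (fun _ : ι => ν) k).map_eq
  rw [he, he] at h
  rw [← integral_prod H (hH.integrable _), ← h, integral_map (by fun_prop)
    hH.measurable.aestronglyMeasurable]

theorem measurable_padF {Y : Type*} [Nonempty Y] [MeasurableSpace Y] (m : ℕ) :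
    Measurable (padF : (Fin m → Y) → ℕ → Y) := by
  refine measurable_pi_iff.2 fun i => ?_
  unfold padF
  split_ifs <;> fun_prop

theorem padF_apply {Y : Type*} [Nonempty Y] {m : ℕ} (f : Fin m → Y) {i : ℕ} (h : i < m) :
    padF f i = f ⟨i, h⟩ := dif_pos h

section Step

variable (M : ℕ → Kernel X X) (G : ℕ → X → ℝ) (Np : ℕ → ℕ) (p : ℕ)

/-- The law of the ancestor index and the position of a single particle of generation `p + 1`,
given the time-`p` configuration `z`. -/
def moveLaw (z : ℕ → X) : Measure (ℕ × X) :=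
  (cat (Np p) fun j => G p (z j)).bind fun a => (M (p + 1) (z a)).map fun x => (a, x)

theorem moveLaw_eq_sum (z : ℕ → X) :
    moveLaw M G Np p z = (∑ j ∈ Finset.range (Np p), ENNReal.ofReal (G p (z j)))⁻¹ •
      ∑ j ∈ Finset.range (Np p),
        ENNReal.ofReal (G p (z j)) • (M (p + 1) (z j)).map fun x => (j, x) := by
  ext s hs
  rw [moveLaw, Measure.bind_apply hs (measurable_of_countable _).aemeasurable, cat,
    lintegral_smul_measure, lintegral_finsetSum_measure]
  simp [lintegral_smul_measure]

variable {M G Np p}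

theorem measurable_moveLaw (hGm : Measurable (G p)) :
    Measurable (moveLaw M G Np p) := by
  refine Measure.measurable_of_measurable_coe _ fun s hs => ?_
  simp only [moveLaw_eq_sum, Measure.smul_apply, Measure.finsetSum_apply, smul_eq_mul]
  have hG (j : ℕ) : Measurable fun z : ℕ → X => ENNReal.ofReal (G p (z j)) :=
    (hGm.comp (measurable_pi_apply j)).ennreal_ofReal
  refine (Finset.measurable_sum _ fun j _ => hG j).inv.mul
    (Finset.measurable_sum _ fun j _ => (hG j).mul ?_)
  simp only [Measure.map_apply measurable_prodMk_left hs]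
  exact ((M (p + 1)).measurable_coe (measurable_prodMk_left hs)).comp (measurable_pi_apply j)

theorem measurable_pad_prod [Nonempty X] (m : ℕ) :
    Measurable fun f : Fin m → ℕ × X =>
      ((padF fun i => (f i).1, padF fun i => (f i).2) : (ℕ → ℕ) × (ℕ → X)) :=
  ((measurable_padF m).comp (by fun_prop)).prodMk ((measurable_padF m).comp (by fun_prop))

theorem integral_pfStep [Nonempty X] {z : ℕ → X} {F : (ℕ → ℕ) × (ℕ → X) → ℝ} (hF : Measurable F) :
    ∫ y, F y ∂(pfStep M G Np p z) =
      ∫ f, F (padF fun i => (f i).1, padF fun i => (f i).2)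
        ∂(Measure.pi fun _ : Fin (Np (p + 1)) => moveLaw M G Np p z) :=
  integral_map (measurable_pad_prod _).aemeasurable hF.aestronglyMeasurable

variable [∀ p, IsMarkovKernel (M p)]

/-- The operator `Q_{p+1}`, that is `φ ↦ G_p · M_{p+1} φ`. -/
def semigroupStep (M : ℕ → Kernel X X) (G : ℕ → X → ℝ) (p : ℕ) (φ : X → ℝ) (x : X) : ℝ :=
  G p x * ∫ y, φ y ∂(M (p + 1) x)

theorem isProbabilityMeasure_moveLaw (hpos : ∀ x, 0 < G p x) (hN : 0 < Np p) (z : ℕ → X) :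
    IsProbabilityMeasure (moveLaw M G Np p z) := by
  constructor
  have hm (j : ℕ) : ((M (p + 1) (z j)).map fun x => (j, x)) Set.univ = 1 := by
    rw [Measure.map_apply (by fun_prop) .univ]; simp
  rw [moveLaw_eq_sum]
  simp only [Measure.smul_apply, Measure.finsetSum_apply, hm, smul_eq_mul, mul_one]
  refine ENNReal.inv_mul_cancel (fun h => ?_) (by simp)
  have := Finset.sum_eq_zero_iff.1 h 0 (by simpa using hN)
  exact absurd (hpos (z 0)) (by simpa using this)

theorem integral_moveLaw (hpos : ∀ x, 0 < G p x) (z : ℕ → X)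
    {f : ℕ × X → ℝ} (hf : BddMeas f) :
    ∫ y, f y ∂(moveLaw M G Np p z) = (∑ j ∈ Finset.range (Np p), G p (z j))⁻¹ *
      ∑ j ∈ Finset.range (Np p), G p (z j) * ∫ x, f (j, x) ∂(M (p + 1) (z j)) := by
  rw [moveLaw_eq_sum, integral_smul_measure, integral_finsetSum_measure]
  · rw [← ENNReal.ofReal_sum_of_nonneg fun j _ => (hpos _).le, ENNReal.toReal_inv,
      ENNReal.toReal_ofReal (Finset.sum_nonneg fun j _ => (hpos _).le), smul_eq_mul]
    congr 1
    refine Finset.sum_congr rfl fun j _ => ?_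
    rw [integral_smul_measure, ENNReal.toReal_ofReal (hpos _).le, smul_eq_mul,
      integral_map (by fun_prop) hf.measurable.aestronglyMeasurable]
  · intro j _
    have : IsProbabilityMeasure ((M (p + 1) (z j)).map fun x => (j, x)) :=
      Measure.isProbabilityMeasure_map (by fun_prop)
    exact (hf.integrable _).smul_measure (by simp)

theorem integral_moveLaw_pair (hpos : ∀ x, 0 < G p x)
    {φ : X → ℝ} (hφ : BddMeas φ) (e : ℕ → ℕ) (z : ℕ → X) :
    ∫ y, ∫ y', (if e y.1 ≠ e y'.1 then φ y.2 * φ y'.2 else 0)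
        ∂(moveLaw M G Np p z) ∂(moveLaw M G Np p z) =
      ((∑ j ∈ Finset.range (Np p), G p (z j))⁻¹) ^ 2 *
        ∑ k ∈ Finset.range (Np p), ∑ l ∈ Finset.range (Np p),
          if e k ≠ e l then semigroupStep M G p φ (z k) * semigroupStep M G p φ (z l) else 0 := by
  set S := (∑ j ∈ Finset.range (Np p), G p (z j))⁻¹
  let c : ℕ → ℝ := fun a =>
    S * ∑ l ∈ Finset.range (Np p), if e a ≠ e l then semigroupStep M G p φ (z l) else 0
  have hc : BddMeas c := (BddMeas.const S).mul
    (BddMeas.sum _ fun l _ => (BddMeas.const _).ite (Set.to_countable _).measurableSet)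
  have h_inner (y : ℕ × X) :
      ∫ y', (if e y.1 ≠ e y'.1 then φ y.2 * φ y'.2 else 0) ∂(moveLaw M G Np p z) =
        φ y.2 * c y.1 := by
    have hf : BddMeas fun y' : ℕ × X => if e y.1 ≠ e y'.1 then φ y.2 * φ y'.2 else 0 :=
      ((BddMeas.const _).mul (hφ.comp measurable_snd)).ite
        (measurable_fst (Set.to_countable {a | e y.1 ≠ e a}).measurableSet)
    simp only [c]
    rw [integral_moveLaw hpos z hf, mul_left_comm (φ y.2)]
    change S * _ = S * _
    rw [Finset.mul_sum _ _ (φ y.2)]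
    congr 1
    refine Finset.sum_congr rfl fun l _ => ?_
    by_cases h : e y.1 = e l
    · simp [h]
    · simp [h, integral_const_mul, semigroupStep, mul_left_comm]
  simp only [h_inner]
  rw [integral_moveLaw hpos z ((hφ.comp measurable_snd).mul (hc.comp measurable_fst)), sq,
    mul_assoc]
  congr 1
  rw [Finset.mul_sum]
  refine Finset.sum_congr rfl fun k _ => ?_
  simp only [integral_mul_const, c]
  rw [← mul_assoc, mul_left_comm, Finset.mul_sum]
  congr 1
  refine Finset.sum_congr rfl fun l _ => ?_
  split_ifs <;> simp [semigroupStep]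

variable [Nonempty X]

theorem isProbabilityMeasure_pfStep (hpos : ∀ x, 0 < G p x) (hN : 0 < Np p) (z : ℕ → X) :
    IsProbabilityMeasure (pfStep M G Np p z) := by
  have := isProbabilityMeasure_moveLaw (M := M) hpos hN
  exact Measure.isProbabilityMeasure_map (μ := Measure.pi fun _ => moveLaw M G Np p z)
    (measurable_pad_prod _).aemeasurable

theorem measurable_pfStep (hGm : Measurable (G p)) (hpos : ∀ x, 0 < G p x) (hN : 0 < Np p) :
    Measurable (pfStep M G Np p) := by
  have := isProbabilityMeasure_moveLaw (M := M) hpos hN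
  exact (Measure.measurable_map _ (measurable_pad_prod _)).comp
    (measurable_measure_pi (κ := moveLaw M G Np p) (measurable_moveLaw hGm))

theorem integral_pfStep_sum (hpos : ∀ x, 0 < G p x) (hN : 0 < Np p)
    {φ : X → ℝ} (hφ : BddMeas φ) (z : ℕ → X) :
    ∫ y, ∑ i ∈ Finset.range (Np (p + 1)), φ (y.2 i) ∂(pfStep M G Np p z) =
      Np (p + 1) * ((∑ j ∈ Finset.range (Np p), G p (z j))⁻¹ *
        ∑ j ∈ Finset.range (Np p), semigroupStep M G p φ (z j)) := by
  have := isProbabilityMeasure_moveLaw (M := M) hpos hN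
  have := isProbabilityMeasure_pfStep (M := M) hpos hN z
  have hφi (i : ℕ) : BddMeas fun y : (ℕ → ℕ) × (ℕ → X) => φ (y.2 i) :=
    hφ.comp (by fun_prop)
  rw [integral_finsetSum _ fun i _ => (hφi i).integrable _, Finset.sum_congr rfl fun i hi => ?_,
    Finset.sum_const, Finset.card_range, nsmul_eq_mul]
  have hi := Finset.mem_range.1 hi
  have hφ' : BddMeas fun y : ℕ × X => φ y.2 := hφ.comp measurable_snd
  rw [integral_pfStep (hφi i).measurable]
  simp only [padF_apply _ hi]
  refine (integral_map (μ := Measure.pi fun _ => moveLaw M G Np p z)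
    (measurable_pi_apply (⟨i, hi⟩ : Fin (Np (p + 1)))).aemeasurable
    hφ'.measurable.aestronglyMeasurable).symm.trans ?_
  rw [(measurePreserving_eval (fun _ => moveLaw M G Np p z) _).map_eq, integral_moveLaw hpos z hφ']
  rfl

theorem integral_pfStep_pair_sum (hpos : ∀ x, 0 < G p x) (hN : 0 < Np p)
    {φ : X → ℝ} (hφ : BddMeas φ) (e : ℕ → ℕ) (z : ℕ → X) :
    ∫ y, ∑ i ∈ Finset.range (Np (p + 1)), ∑ j ∈ Finset.range (Np (p + 1)),
        (if e (y.1 i) ≠ e (y.1 j) then φ (y.2 i) * φ (y.2 j) else 0) ∂(pfStep M G Np p z) =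
      Np (p + 1) * (Np (p + 1) - 1) * (((∑ j ∈ Finset.range (Np p), G p (z j))⁻¹) ^ 2 *
        ∑ k ∈ Finset.range (Np p), ∑ l ∈ Finset.range (Np p),
          if e k ≠ e l then
            semigroupStep M G p φ (z k) * semigroupStep M G p φ (z l) else 0) := by
  have := isProbabilityMeasure_moveLaw (M := M) hpos hN
  have := isProbabilityMeasure_pfStep (M := M) hpos hN z
  rw [← integral_moveLaw_pair hpos hφ e z]
  set K := ∫ y, ∫ y', (if e y.1 ≠ e y'.1 then φ y.2 * φ y'.2 else 0)
        ∂(moveLaw M G Np p z) ∂(moveLaw M G Np p z)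
  have hH : BddMeas fun q : (ℕ × X) × (ℕ × X) =>
      if e q.1.1 ≠ e q.2.1 then φ q.1.2 * φ q.2.2 else 0 :=
    ((hφ.comp (by fun_prop)).mul (hφ.comp (by fun_prop))).ite
      ((show Measurable fun q : (ℕ × X) × (ℕ × X) => (q.1.1, q.2.1) by fun_prop)
        (Set.to_countable {a : ℕ × ℕ | e a.1 ≠ e a.2}).measurableSet)
  have hHij (i j : ℕ) : BddMeas fun y : (ℕ → ℕ) × (ℕ → X) =>
      if e (y.1 i) ≠ e (y.1 j) then φ (y.2 i) * φ (y.2 j) else 0 :=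
    hH.comp (g := fun y : (ℕ → ℕ) × (ℕ → X) => ((y.1 i, y.2 i), (y.1 j, y.2 j))) (by fun_prop)
  have h_term : ∀ i ∈ Finset.range (Np (p + 1)), ∀ j ∈ Finset.range (Np (p + 1)),
      ∫ y, (if e (y.1 i) ≠ e (y.1 j) then φ (y.2 i) * φ (y.2 j) else 0) ∂(pfStep M G Np p z) =
        K - if i = j then K else 0 := by
    intro i hi j hj
    rw [Finset.mem_range] at hi hj
    by_cases hij : i = j
    · simp [hij]
    rw [integral_pfStep (hHij i j).measurable]
    simp only [padF_apply _ hi, padF_apply _ hj, hij, if_false, sub_zero]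
    exact integral_pi_pair (moveLaw M G Np p z) (i := (⟨i, hi⟩ : Fin (Np (p + 1))))
      (j := ⟨j, hj⟩) (by simpa using hij) hH
  rw [integral_finsetSum _ fun i _ => (BddMeas.sum _ fun j _ => hHij i j).integrable _]
  simp only [integral_finsetSum _ fun j _ => (hHij _ j).integrable _]
  rw [Finset.sum_congr rfl fun i hi => Finset.sum_congr rfl (h_term i hi)]
  simp +contextual [Finset.sum_sub_distrib, Finset.sum_ite_eq]
  ring

end Step

theorem BddMeas.semigroupStep {M : ℕ → Kernel X X} [∀ p, IsMarkovKernel (M p)] {G : ℕ → X → ℝ}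
    {p : ℕ} (hG : BddMeas (G p)) {φ : X → ℝ} (hφ : BddMeas φ) :
    BddMeas (semigroupStep M G p φ) :=
  hG.mul (hφ.integral_kernel (M (p + 1)))

/-- The unnormalized Feynman–Kac functional `γ_n(φ) = M_0 Q_1 ⋯ Q_n φ`. -/
def feynmanKac (M0 : Measure X) (M : ℕ → Kernel X X) (G : ℕ → X → ℝ) : ℕ → (X → ℝ) → ℝ
  | 0, φ => ∫ x, φ x ∂M0
  | p + 1, φ => feynmanKac M0 M G p (semigroupStep M G p φ)

/-- Sum of `φ ⊗ φ` over the pairs of particles with distinct Eve indices. -/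
def distinctEveSum (Np : ℕ → ℕ) (n : ℕ) (φ : X → ℝ) (ω : (ℕ → ℕ → X) × (ℕ → ℕ → ℕ)) : ℝ :=
  ∑ i ∈ Finset.range (Np n), ∑ j ∈ Finset.range (Np n),
    if eve ω.2 n i ≠ eve ω.2 n j then φ (ω.1 n i) * φ (ω.1 n j) else 0

/-- Append the ancestor indices `y.1` and the positions `y.2` of generation `k + 1`. -/
def appendGen (k : ℕ) (ω : (ℕ → ℕ → X) × (ℕ → ℕ → ℕ)) (y : (ℕ → ℕ) × (ℕ → X)) :
    (ℕ → ℕ → X) × (ℕ → ℕ → ℕ) :=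
  (Function.update ω.1 (k + 1) y.2, Function.update ω.2 k y.1)

theorem measurable_appendGen (k : ℕ) :
    Measurable fun q : ((ℕ → ℕ → X) × (ℕ → ℕ → ℕ)) × ((ℕ → ℕ) × (ℕ → X)) =>
      appendGen k q.1 q.2 := by
  unfold appendGen
  refine .prodMk (measurable_pi_iff.2 fun p => ?_) (measurable_pi_iff.2 fun p => ?_) <;>
  · simp only [Function.update_apply]
    split_ifs <;> fun_prop

theorem eve_congr {A B : ℕ → ℕ → ℕ} {p : ℕ} (h : ∀ q < p, A q = B q) : eve A p = eve B p := by
  induction p with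
  | zero => rfl
  | succ p ih =>
    funext i
    simp only [eve, h p p.lt_succ_self, ih fun q hq => h q (hq.trans p.lt_succ_self)]

theorem eve_appendGen {Y : Type*} (k : ℕ) (ω : (ℕ → ℕ → Y) × (ℕ → ℕ → ℕ))
    (y : (ℕ → ℕ) × (ℕ → Y)) (i : ℕ) :
    eve (appendGen k ω y).2 (k + 1) i = eve ω.2 k (y.1 i) := by
  have h : eve (appendGen k ω y).2 k = eve ω.2 k :=
    eve_congr fun q hq => Function.update_of_ne hq.ne _ _
  simp only [eve, h]
  simp [appendGen]

theorem etaN_appendGen {Y : Type*} (Np : ℕ → ℕ) {k p : ℕ} (hp : p ≤ k) (f : Y → ℝ)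
    (ω : (ℕ → ℕ → Y) × (ℕ → ℕ → ℕ)) (y : (ℕ → ℕ) × (ℕ → Y)) :
    etaN Np p f (appendGen k ω y) = etaN Np p f ω := by
  simp [etaN, appendGen, Function.update_of_ne (show p ≠ k + 1 by omega)]

theorem measurable_eve (p i : ℕ) : Measurable fun A : ℕ → ℕ → ℕ => eve A p i := by
  induction p generalizing i with
  | zero => exact measurable_const
  | succ p ih =>
    have h : Measurable fun q : (ℕ → ℕ → ℕ) × ℕ => eve q.1 p q.2 :=
      measurable_from_prod_countable_left fun i => ih i
    exact h.comp (g := fun q : (ℕ → ℕ → ℕ) × ℕ => eve q.1 p q.2)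
      (f := fun A : ℕ → ℕ → ℕ => (A, A p i)) (by fun_prop)

theorem BddMeas.comp_particle {φ : X → ℝ} (hφ : BddMeas φ) (p i : ℕ) :
    BddMeas fun ω : (ℕ → ℕ → X) × (ℕ → ℕ → ℕ) => φ (ω.1 p i) :=
  hφ.comp (by fun_prop)

theorem BddMeas.etaN {φ : X → ℝ} (hφ : BddMeas φ) (Np : ℕ → ℕ) (p : ℕ) :
    BddMeas (etaN Np p φ) :=
  (BddMeas.const _).mul (.sum _ fun i _ => hφ.comp_particle p i)

theorem BddMeas.prod_etaN {G : ℕ → X → ℝ} {n : ℕ} (hG : ∀ p < n, BddMeas (G p)) (Np : ℕ → ℕ) :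
    BddMeas fun ω => ∏ p ∈ Finset.range n, PFVar.etaN Np p (G p) ω :=
  .prod _ fun p hp => (hG p (Finset.mem_range.1 hp)).etaN Np p

theorem BddMeas.gammaN {G : ℕ → X → ℝ} {n : ℕ} (hG : ∀ p < n, BddMeas (G p)) (Np : ℕ → ℕ)
    {φ : X → ℝ} (hφ : BddMeas φ) : BddMeas (gammaN G Np n φ) :=
  (prod_etaN hG Np).mul (hφ.etaN Np n)

theorem BddMeas.distinctEveSum {φ : X → ℝ} (hφ : BddMeas φ) (Np : ℕ → ℕ) (n : ℕ) :
    BddMeas (distinctEveSum Np n φ) :=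
  .sum _ fun i _ => .sum _ fun j _ =>
    ((hφ.comp_particle n i).mul (hφ.comp_particle n j)).ite
      (measurableSet_eq_fun ((measurable_eve n i).comp measurable_snd)
        ((measurable_eve n j).comp measurable_snd)).compl

section Law

variable [Nonempty X] {M0 : Measure X} {M : ℕ → Kernel X X} {G : ℕ → X → ℝ} {Np : ℕ → ℕ}

theorem measurable_initial (m : ℕ) :
    Measurable fun f : Fin m → X =>
      ((fun p => if p = 0 then padF f else fun _ => Classical.arbitrary X, fun _ _ => 0) :
        (ℕ → ℕ → X) × (ℕ → ℕ → ℕ)) := by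
  refine .prodMk (measurable_pi_iff.2 fun p => ?_) measurable_const
  split_ifs
  · exact measurable_padF m
  · exact measurable_const

theorem integral_pfLaw_zero {F : (ℕ → ℕ → X) × (ℕ → ℕ → ℕ) → ℝ} (hF : Measurable F) :
    ∫ ω, F ω ∂(pfLaw M0 M G Np 0) =
      ∫ f, F (fun p => if p = 0 then padF f else fun _ => Classical.arbitrary X, fun _ _ => 0)
        ∂(Measure.pi fun _ : Fin (Np 0) => M0) :=
  integral_map (measurable_initial _).aemeasurable hF.aestronglyMeasurable

variable [IsProbabilityMeasure M0] [∀ p, IsMarkovKernel (M p)]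

theorem measurable_transition {k : ℕ} (hGm : Measurable (G k)) (hpos : ∀ x, 0 < G k x)
    (hN : 0 < Np k) :
    Measurable fun ω : (ℕ → ℕ → X) × (ℕ → ℕ → ℕ) =>
      (pfStep M G Np k (ω.1 k)).map (appendGen k ω) := by
  have := isProbabilityMeasure_pfStep (M := M) hpos hN
  exact measurable_map_prodMk
    (κ := fun ω : (ℕ → ℕ → X) × (ℕ → ℕ → ℕ) => pfStep M G Np k (ω.1 k))
    ((measurable_pfStep hGm hpos hN).comp (by fun_prop)) (measurable_appendGen k)

theorem isProbabilityMeasure_transition {k : ℕ} (hpos : ∀ x, 0 < G k x) (hN : 0 < Np k)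
    (ω : (ℕ → ℕ → X) × (ℕ → ℕ → ℕ)) :
    IsProbabilityMeasure ((pfStep M G Np k (ω.1 k)).map (appendGen k ω)) := by
  have := isProbabilityMeasure_pfStep (M := M) hpos hN (ω.1 k)
  exact Measure.isProbabilityMeasure_map
    ((measurable_appendGen k).comp measurable_prodMk_left).aemeasurable

theorem isProbabilityMeasure_pfLaw {n : ℕ} (hGm : ∀ p < n, Measurable (G p))
    (hpos : ∀ p < n, ∀ x, 0 < G p x) (hN : ∀ p < n, 0 < Np p) :
    IsProbabilityMeasure (pfLaw M0 M G Np n) := by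
  induction n with
  | zero => exact Measure.isProbabilityMeasure_map (measurable_initial _).aemeasurable
  | succ n ih =>
    have := ih (fun p hp => hGm p (by omega)) (fun p hp => hpos p (by omega))
      fun p hp => hN p (by omega)
    have hn := n.lt_succ_self
    have ht := isProbabilityMeasure_transition (M := M) (hpos n hn) (hN n hn)
    exact isProbabilityMeasure_bind
      (measurable_transition (M := M) (hGm n hn) (hpos n hn) (hN n hn)).aemeasurable
      (.of_forall ht)

theorem integral_pfLaw_succ {n : ℕ} (hGm : ∀ p < n + 1, Measurable (G p))
    (hpos : ∀ p < n + 1, ∀ x, 0 < G p x) (hN : ∀ p < n + 1, 0 < Np p)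
    {F : (ℕ → ℕ → X) × (ℕ → ℕ → ℕ) → ℝ} (hF : BddMeas F) :
    ∫ ω, F ω ∂(pfLaw M0 M G Np (n + 1)) =
      ∫ ω, ∫ y, F (appendGen n ω y) ∂(pfStep M G Np n (ω.1 n)) ∂(pfLaw M0 M G Np n) := by
  have := isProbabilityMeasure_pfLaw (M0 := M0) (M := M) (fun p hp => hGm p (by omega))
    (fun p (hp : p < n) => hpos p (by omega)) fun p hp => hN p (by omega)
  have hn := n.lt_succ_self
  have ht := isProbabilityMeasure_transition (M := M) (hpos n hn) (hN n hn)
  refine (integral_bind_bddMeas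
    (measurable_transition (M := M) (hGm n hn) (hpos n hn) (hN n hn)) hF).trans ?_
  refine integral_congr_ae (.of_forall fun ω => ?_)
  exact integral_map ((measurable_appendGen n).comp measurable_prodMk_left).aemeasurable
    hF.measurable.aestronglyMeasurable

/-- Unbiasedness of `γ_n^N(φ)`. -/
theorem integral_gammaN {n : ℕ} (hG : ∀ p < n, BddMeas (G p))
    (hpos : ∀ p < n, ∀ x, 0 < G p x) (hN : ∀ p ≤ n, 0 < Np p)
    {φ : X → ℝ} (hφ : BddMeas φ) :
    ∫ ω, gammaN G Np n φ ω ∂(pfLaw M0 M G Np n) = feynmanKac M0 M G n φ := by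
  induction n generalizing φ with
  | zero =>
    have hN0 : (Np 0 : ℝ) ≠ 0 := by exact_mod_cast (hN 0 le_rfl).ne'
    rw [integral_pfLaw_zero (hφ.gammaN hG Np).measurable]
    simp only [gammaN, etaN, Finset.range_zero, Finset.prod_empty, one_mul, if_true,
      integral_const_mul, feynmanKac]
    have hφi (i : Fin (Np 0)) : BddMeas fun f : Fin (Np 0) → X => φ (f i) :=
      hφ.comp (measurable_pi_apply i)
    have h (f : Fin (Np 0) → X) :
        ∑ i ∈ Finset.range (Np 0), φ (padF f i) = ∑ i, φ (f i) := by
      rw [Finset.sum_range]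
      exact Finset.sum_congr rfl fun i _ => by rw [padF_apply f i.2]
    simp only [h]
    rw [integral_finsetSum _ fun i _ => (hφi i).integrable _]
    have hi (i : Fin (Np 0)) :
        ∫ f : Fin (Np 0) → X, φ (f i) ∂(Measure.pi fun _ => M0) = ∫ x, φ x ∂M0 := by
      rw [← integral_map (φ := fun f : Fin (Np 0) → X => f i) (measurable_pi_apply i).aemeasurable
        hφ.measurable.aestronglyMeasurable, (measurePreserving_eval (fun _ => M0) i).map_eq]
    simp [hi, hN0]
  | succ n ih =>
    have hn := n.lt_succ_self
    have hNn : (Np n : ℝ) ≠ 0 := by exact_mod_cast (hN n n.le_succ).ne'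
    have hNs : (Np (n + 1) : ℝ) ≠ 0 := by exact_mod_cast (hN _ le_rfl).ne'
    rw [integral_pfLaw_succ (fun p hp => (hG p hp).measurable) hpos
      (fun p hp => hN p hp.le) (hφ.gammaN hG Np), feynmanKac,
      ← ih (fun p hp => hG p (by omega)) (fun p hp => hpos p (by omega))
        (fun p hp => hN p (by omega)) ((hG n hn).semigroupStep hφ)]
    congr 1 with ω
    have hS : ∑ j ∈ Finset.range (Np n), G n (ω.1 n j) ≠ 0 :=
      (Finset.sum_pos (fun j _ => hpos n hn _) ⟨0, by simpa using hN n n.le_succ⟩).ne'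
    have h (y : (ℕ → ℕ) × (ℕ → X)) : gammaN G Np (n + 1) φ (appendGen n ω y) =
        (∏ p ∈ Finset.range (n + 1), etaN Np p (G p) ω) * ((Np (n + 1) : ℝ)⁻¹ *
          ∑ i ∈ Finset.range (Np (n + 1)), φ (y.2 i)) := by
      rw [gammaN, Finset.prod_congr rfl fun p hp =>
        etaN_appendGen Np (Nat.lt_succ_iff.1 (Finset.mem_range.1 hp)) (G p) ω y]
      simp [etaN, appendGen]
    simp only [h, integral_const_mul]
    rw [integral_pfStep_sum (hpos n hn) (hN n n.le_succ) hφ, Finset.prod_range_succ]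
    simp only [gammaN, etaN]
    field_simp

theorem integral_distinctEveSum {n : ℕ} (hG : ∀ p < n, BddMeas (G p))
    (hpos : ∀ p < n, ∀ x, 0 < G p x) (hN : ∀ p ≤ n, 0 < Np p)
    {φ : X → ℝ} (hφ : BddMeas φ) :
    ∫ ω, (∏ p ∈ Finset.range n, etaN Np p (G p) ω) ^ 2 * distinctEveSum Np n φ ω
        ∂(pfLaw M0 M G Np n) =
      (∏ p ∈ Finset.range n, ((Np p : ℝ) - 1) / Np p) * (Np n * (Np n - 1)) *
        feynmanKac M0 M G n φ ^ 2 := by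
  have hF {n : ℕ} (hG : ∀ p < n, BddMeas (G p)) {φ : X → ℝ} (hφ : BddMeas φ) :
      BddMeas fun ω => (∏ p ∈ Finset.range n, etaN Np p (G p) ω) ^ 2 * distinctEveSum Np n φ ω :=
    ((BddMeas.prod_etaN hG Np).pow 2).mul (hφ.distinctEveSum Np n)
  induction n generalizing φ with
  | zero =>
    rw [integral_pfLaw_zero (hF hG hφ).measurable]
    simp only [Finset.range_zero, Finset.prod_empty, one_pow, one_mul, if_true, distinctEveSum,
      eve, feynmanKac]
    have h (f : Fin (Np 0) → X) :
        (∑ i ∈ Finset.range (Np 0), ∑ j ∈ Finset.range (Np 0),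
          if i ≠ j then φ (padF f i) * φ (padF f j) else 0) =
        ∑ i : Fin (Np 0), ∑ j : Fin (Np 0), if i ≠ j then φ (f i) * φ (f j) else 0 := by
      simp only [Finset.sum_range, padF_apply f (Fin.is_lt _), Fin.eta, Fin.val_inj, ne_eq]
    simp only [h]
    have hij (i j : Fin (Np 0)) : BddMeas fun f : Fin (Np 0) → X =>
        if i ≠ j then φ (f i) * φ (f j) else 0 :=
      ((hφ.comp (measurable_pi_apply i)).mul (hφ.comp (measurable_pi_apply j))).ite (.const _)
    have h_term (i j : Fin (Np 0)) :
        ∫ f : Fin (Np 0) → X, (if i ≠ j then φ (f i) * φ (f j) else 0)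
          ∂(Measure.pi fun _ => M0) =
        (∫ x, φ x ∂M0) ^ 2 - if i = j then (∫ x, φ x ∂M0) ^ 2 else 0 := by
      by_cases hne : i = j
      · simp [hne]
      simp only [hne, ne_eq, not_false_eq_true, if_true, if_false, sub_zero]
      rw [integral_pi_pair M0 hne (H := fun q => φ q.1 * φ q.2)
        ((hφ.comp measurable_fst).mul (hφ.comp measurable_snd))]
      simp only [integral_const_mul, integral_mul_const, sq]
    rw [integral_finsetSum _ fun i _ => (BddMeas.sum _ fun j _ => hij i j).integrable _]
    simp only [integral_finsetSum _ fun j _ => (hij _ j).integrable _, h_term]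
    simp [Finset.sum_sub_distrib]
    ring
  | succ n ih =>
    have hn := n.lt_succ_self
    have hNn : (Np n : ℝ) ≠ 0 := by exact_mod_cast (hN n n.le_succ).ne'
    rw [integral_pfLaw_succ (fun p hp => (hG p hp).measurable) hpos
      (fun p hp => hN p hp.le) (hF hG hφ), feynmanKac]
    have h_inner (ω : (ℕ → ℕ → X) × (ℕ → ℕ → ℕ)) :
        ∫ y, (∏ p ∈ Finset.range (n + 1), etaN Np p (G p) (appendGen n ω y)) ^ 2 *
          distinctEveSum Np (n + 1) φ (appendGen n ω y) ∂(pfStep M G Np n (ω.1 n)) =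
        Np (n + 1) * (Np (n + 1) - 1) * ((Np n : ℝ)⁻¹) ^ 2 *
          ((∏ p ∈ Finset.range n, etaN Np p (G p) ω) ^ 2 *
            distinctEveSum Np n (semigroupStep M G n φ) ω) := by
      have hS : ∑ j ∈ Finset.range (Np n), G n (ω.1 n j) ≠ 0 :=
        (Finset.sum_pos (fun j _ => hpos n hn _) ⟨0, by simpa using hN n n.le_succ⟩).ne'
      have h (y : (ℕ → ℕ) × (ℕ → X)) :
          (∏ p ∈ Finset.range (n + 1), etaN Np p (G p) (appendGen n ω y)) ^ 2 *
            distinctEveSum Np (n + 1) φ (appendGen n ω y) =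
          (∏ p ∈ Finset.range (n + 1), etaN Np p (G p) ω) ^ 2 *
            ∑ i ∈ Finset.range (Np (n + 1)), ∑ j ∈ Finset.range (Np (n + 1)),
              if eve ω.2 n (y.1 i) ≠ eve ω.2 n (y.1 j) then φ (y.2 i) * φ (y.2 j) else 0 := by
        rw [Finset.prod_congr rfl fun p hp =>
          etaN_appendGen Np (Nat.lt_succ_iff.1 (Finset.mem_range.1 hp)) (G p) ω y]
        simp only [distinctEveSum, eve_appendGen]
        simp [appendGen]
      simp only [h, integral_const_mul]
      rw [integral_pfStep_pair_sum (hpos n hn) (hN n n.le_succ) hφ, Finset.prod_range_succ]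
      have h_eta : etaN Np n (G n) ω =
          (Np n : ℝ)⁻¹ * ∑ j ∈ Finset.range (Np n), G n (ω.1 n j) := rfl
      rw [h_eta, distinctEveSum]
      field_simp
    simp only [h_inner, integral_const_mul]
    rw [ih (fun p hp => hG p (by omega)) (fun p hp => hpos p (by omega))
      (fun p hp => hN p (by omega)) ((hG n hn).semigroupStep hφ), Finset.prod_range_succ]
    field_simp

end Law

theorem statement2
    {X : Type*} [MeasurableSpace X] [Nonempty X] (hX : ∃ x y : X, x ≠ y) (n : ℕ)
    (M0 : Measure X) [IsProbabilityMeasure M0]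
    (M : ℕ → Kernel X X) [∀ p, IsMarkovKernel (M p)]
    (G : ℕ → X → ℝ) (hGm : ∀ p ≤ n, Measurable (G p))
    (hGpos : ∀ p ≤ n, ∀ x, 0 < G p x) (hGbd : ∀ p ≤ n, ∃ C, ∀ x, G p x ≤ C)
    (c : ℕ → ℝ) (hc : ∀ p ≤ n, 0 < c p)
    (φ : X → ℝ) (hφm : Measurable φ) (hφb : ∃ C, ∀ x, |φ x| ≤ C) :
    ∀ N : ℕ, 1 ≤ N → (∀ p ≤ n, 2 ≤ npart c N p) →
      ∫ ω, gammaN G (npart c N) n (1 : X → ℝ) ω ^ 2 * Vest (npart c N) n φ ω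
          ∂(pfLaw M0 M G (npart c N) n)
        = variance (fun ω => gammaN G (npart c N) n φ ω) (pfLaw M0 M G (npart c N) n) := by
  intro N _ hN2
  generalize npart c N = Np at hN2 ⊢
  have hN : ∀ p ≤ n, 0 < Np p := fun p hp => by have := hN2 p hp; omega
  have hφ : BddMeas φ := ⟨hφm, hφb⟩
  have hG : ∀ p < n, BddMeas (G p) := fun p hp =>
    ⟨hGm p hp.le, (hGbd p hp.le).imp fun C hC x => by
      rw [abs_of_pos (hGpos p hp.le x)]; exact hC x⟩
  have hpos : ∀ p < n, ∀ x, 0 < G p x := fun p hp => hGpos p hp.le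
  have := isProbabilityMeasure_pfLaw (M0 := M0) (M := M) (fun p hp => (hG p hp).measurable) hpos
    fun p hp => hN p hp.le
  have hγ := hφ.gammaN hG Np
  rw [variance_eq_sub (hγ.memLp _ 2), integral_gammaN hG hpos hN hφ]
  have hN1 (p : ℕ) (hp : p ≤ n) : (Np p : ℝ) ≠ 0 ∧ (Np p : ℝ) - 1 ≠ 0 := by
    have : (2 : ℝ) ≤ Np p := by exact_mod_cast hN2 p hp
    constructor <;> linarith
  obtain ⟨hn0, hn1⟩ := hN1 n le_rfl
  set D := (∏ p ∈ Finset.range n, (Np p : ℝ) / ((Np p : ℝ) - 1)) *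
    ((Np n : ℝ) * ((Np n : ℝ) - 1))⁻¹
  have h_eq (ω : (ℕ → ℕ → X) × (ℕ → ℕ → ℕ)) :
      gammaN G Np n (1 : X → ℝ) ω ^ 2 * Vest Np n φ ω =
        gammaN G Np n φ ω ^ 2 - D *
          ((∏ p ∈ Finset.range n, etaN Np p (G p) ω) ^ 2 * distinctEveSum Np n φ ω) := by
    have h_one : etaN Np n (1 : X → ℝ) ω = 1 := by simp [etaN, hn0]
    change _ * (_ - D * distinctEveSum Np n φ ω) = _
    rw [gammaN, gammaN, h_one]
    ring
  have hD : BddMeas fun ω => D *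
      ((∏ p ∈ Finset.range n, etaN Np p (G p) ω) ^ 2 * distinctEveSum Np n φ ω) :=
    (BddMeas.const D).mul (((BddMeas.prod_etaN hG Np).pow 2).mul (hφ.distinctEveSum Np n))
  simp only [h_eq]
  rw [integral_sub ((hγ.pow 2).integrable _) (hD.integrable _), integral_const_mul,
    integral_distinctEveSum hG hpos hN hφ, ← mul_assoc]
  have hD_one : D * ((∏ p ∈ Finset.range n, ((Np p : ℝ) - 1) / Np p) * (Np n * (Np n - 1))) = 1 := by
    rw [mul_mul_mul_comm, ← Finset.prod_mul_distrib, inv_mul_cancel₀ (mul_ne_zero hn0 hn1),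
      mul_one]
    refine Finset.prod_eq_one fun p hp => ?_
    obtain ⟨h0, h1⟩ := hN1 p (Finset.mem_range.1 hp).le
    field_simp
  rw [hD_one, one_mul]
  rfl
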